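/- arXiv:2605.18061 — 4 statements merged into one kernel-verified Lean document; each statement's English description precedes it below -/
import Mathlib

section
/- Let A be a 2×2 real matrix with det(A) = 1. Then ∑_{k=1}^{9} A^k = (tr(A) + 1)(tr(A³) + 1) · A⁵. -/
open Matrix

theorem stmt_1 (A : Matrix (Fin 2) (Fin 2) ℝ) (hA : A.det = 1) :
    ∑ k ∈ Finset.Icc 1 9, A ^ k = ((A.trace + 1) * ((A ^ 3).trace + 1)) • A ^ 5 := by
  have h2 : A ^ 2 = A.trace • A - (1 : Matrix (Fin 2) (Fin 2) ℝ) := by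
    rw [Matrix.det_fin_two] at hA
    ext i j
    fin_cases i <;> fin_cases j <;>
      simp [pow_two, Matrix.mul_apply, Fin.sum_univ_two, Matrix.trace_fin_two] <;> linarith
  have step : ∀ (n : ℕ) (p q : ℝ), A ^ n = p • A + q • (1 : Matrix (Fin 2) (Fin 2) ℝ) →
      A ^ (n + 1) = (p * A.trace + q) • A + (-p) • (1 : Matrix (Fin 2) (Fin 2) ℝ) := by
    intro n p q h
    rw [pow_succ, h, add_mul, smul_mul_assoc, smul_mul_assoc, one_mul, ← pow_two, h2]
    module
  have h1 : A ^ 1 = (1 : ℝ) • A + (0 : ℝ) • (1 : Matrix (Fin 2) (Fin 2) ℝ) := by simp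
  have e2 := step 1 _ _ h1
  have e3 := step 2 _ _ e2
  have e4 := step 3 _ _ e3
  have e5 := step 4 _ _ e4
  have e6 := step 5 _ _ e5
  have e7 := step 6 _ _ e6
  have e8 := step 7 _ _ e7
  have e9 := step 8 _ _ e8
  have t3 : (A ^ 3).trace = A.trace ^ 3 - 3 * A.trace := by
    rw [e3]
    simp only [Matrix.trace_add, Matrix.trace_smul, Matrix.trace_one, Fintype.card_fin, smul_eq_mul]
    push_cast
    ring
  have hs : ∑ k ∈ Finset.Icc 1 9, A ^ k =
      A ^ 1 + A ^ 2 + A ^ 3 + A ^ 4 + A ^ 5 + A ^ 6 + A ^ 7 + A ^ 8 + A ^ 9 := by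
    rw [← Finset.sum_Ioc_add_eq_sum_Icc (by norm_num)]
    simp [Finset.sum_Ioc_succ_top]
    abel
  rw [hs, t3]
  norm_num only at e2 e3 e4 e5 e6 e7 e8 e9
  rw [h1, e2, e3, e4, e5, e6, e7, e8, e9]
  generalize A.trace = t
  module
end

section
/- Let A be a 2×2 real matrix with det(A) = 1. Then ∑_{k=1}^{27} A^k = (tr(A) + 1)(tr(A³) + 1)(tr(A⁹) + 1) · A^{14}. -/
open Matrix

theorem key_aux (B : Matrix (Fin 2) (Fin 2) ℝ) (hB : B.det = 1) :
    1 + B + B ^ 2 = (B.trace + 1) • B := by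
  rw [Matrix.det_fin_two] at hB
  ext i j
  fin_cases i <;> fin_cases j <;>
    simp [pow_two, Matrix.mul_apply, Fin.sum_univ_two, Matrix.trace_fin_two] <;> linarith

theorem stmt_2 (A : Matrix (Fin 2) (Fin 2) ℝ) (hA : A.det = 1) :
    ∑ k ∈ Finset.Icc 1 27, A ^ k =
      ((A.trace + 1) * ((A ^ 3).trace + 1) * ((A ^ 9).trace + 1)) • A ^ 14 := by
  have h1 := key_aux A hA
  have h3 := key_aux (A ^ 3) (by rw [Matrix.det_pow, hA, one_pow])
  have h9 := key_aux (A ^ 9) (by rw [Matrix.det_pow, hA, one_pow])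
  have e : ∑ k ∈ Finset.Icc 1 27, A ^ k =
      A * (1 + A + A ^ 2) * (1 + A ^ 3 + (A ^ 3) ^ 2) * (1 + A ^ 9 + (A ^ 9) ^ 2) := by
    have : Finset.Icc 1 27 = Finset.Ico 1 28 := rfl
    rw [this, Finset.sum_Ico_eq_sum_range]
    simp only [Finset.sum_range_succ, Finset.sum_range_zero, Nat.reduceSub, Nat.reduceAdd]
    simp only [mul_add, add_mul, ← pow_mul, mul_one, ← pow_succ, ← pow_succ', ← pow_add, ← pow_two]
    norm_num
    abel
  rw [e, h1, h3, h9]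
  simp only [Matrix.mul_smul, Matrix.smul_mul, smul_smul, ← pow_succ, ← pow_add, ← pow_two]
  congr 1
  ring
end

section
/- Let A be a 2×2 real matrix with det(A) = 1 and let n be a positive natural number. Then ∑_{k=1}^{3^n} A^k = (∏_{j=0}^{n-1} (tr(A^{3^j}) + 1)) · A^{(3^n + 1)/2}. -/
open Matrix

lemma aux_ch (B : Matrix (Fin 2) (Fin 2) ℝ) (hB : B.det = 1) :
    1 + B + B * B = (B.trace + 1) • B := by
  rw [Matrix.det_fin_two] at hB
  ext i j
  fin_cases i <;> fin_cases j <;>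
    simp [Matrix.mul_apply, Fin.sum_univ_two, Matrix.trace_fin_two] <;> linarith

lemma aux_sum (A : Matrix (Fin 2) (Fin 2) ℝ) (hA : A.det = 1) (n : ℕ) :
    ∑ k ∈ Finset.range (3 ^ n), A ^ (k + 1) =
      (∏ j ∈ Finset.range n, ((A ^ 3 ^ j).trace + 1)) • A ^ ((3 ^ n + 1) / 2) := by
  induction n with
  | zero => simp
  | succ n ih =>
    have h3 : 3 ^ (n + 1) = 3 ^ n + 3 ^ n + 3 ^ n := by ring
    have hodd : (3 ^ n) % 2 = 1 := Nat.odd_iff.mp (Odd.pow (by decide))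
    have he : (3 ^ (n + 1) + 1) / 2 = 3 ^ n + (3 ^ n + 1) / 2 := by omega
    have hB := aux_ch (A ^ 3 ^ n) (by rw [Matrix.det_pow, hA, one_pow])
    have hs : ∑ k ∈ Finset.range (3 ^ (n + 1)), A ^ (k + 1) =
        (1 + A ^ 3 ^ n + A ^ 3 ^ n * A ^ 3 ^ n) *
          ∑ k ∈ Finset.range (3 ^ n), A ^ (k + 1) := by
      rw [h3, Finset.sum_range_add, Finset.sum_range_add, add_mul, add_mul, one_mul,
        Finset.mul_sum, Finset.mul_sum]
      simp only [← pow_add, add_assoc]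
    rw [hs, hB, ih, Finset.prod_range_succ, he, pow_add, smul_mul_assoc, mul_smul_comm,
      smul_smul, mul_comm]

theorem stmt_3 (A : Matrix (Fin 2) (Fin 2) ℝ) (hA : A.det = 1) (n : ℕ) (hn : 0 < n) :
    ∑ k ∈ Finset.Icc 1 (3 ^ n), A ^ k =
      (∏ j ∈ Finset.range n, ((A ^ 3 ^ j).trace + 1)) • A ^ ((3 ^ n + 1) / 2) := by
  rw [← aux_sum A hA n, Finset.range_eq_Ico, Finset.sum_Ico_add' (fun k => A ^ k) 0 (3 ^ n) 1]
  rfl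
end

section
/- Let S be a rack and define W(x, y) = (x, x ◃ y) and Z(x, y) = (y ◃⁻¹ x, y) on S × S. Then W¹² ∘ Z¹³ ∘ Z²³ = Z²³ ∘ Z¹³ ∘ W¹² as maps S³ → S³ (one of the compatibility equations making W, exp_e, Z a Yang–Baxter system). -/
open scoped Quandles

/-- Apply `R` to the first two coordinates of a triple. -/
def map12 {S : Type*} (R : S × S → S × S) : S × S × S → S × S × S :=
  fun p => ((R (p.1, p.2.1)).1, (R (p.1, p.2.1)).2, p.2.2)

/-- Apply `R` to the first and third coordinates of a triple. -/
def map13 {S : Type*} (R : S × S → S × S) : S × S × S → S × S × S :=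
  fun p => ((R (p.1, p.2.2)).1, p.2.1, (R (p.1, p.2.2)).2)

/-- Apply `R` to the last two coordinates of a triple. -/
def map23 {S : Type*} (R : S × S → S × S) : S × S × S → S × S × S :=
  fun p => (p.1, R p.2)

/-- The usual Yang–Baxter solution `W (x, y) = (x, x ◃ y)` arising from a rack. -/
def Wmap {S : Type*} [Rack S] (p : S × S) : S × S :=
  (p.1, p.1 ◃ p.2)

/-- The map `Z (x, y) = (y ◃⁻¹ x, y)`. -/
def Zmap {S : Type*} [Rack S] (p : S × S) : S × S :=
  (p.2 ◃⁻¹ p.1, p.2)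

theorem stmt_18 {S : Type*} [Rack S] :
    map12 (Wmap (S := S)) ∘ map13 Zmap ∘ map23 Zmap =
      map23 Zmap ∘ map13 Zmap ∘ map12 Wmap := by
  funext p
  obtain ⟨x, y, z⟩ := p
  have h : (z ◃⁻¹ x) ◃ (z ◃⁻¹ y) = z ◃⁻¹ (x ◃ y) := by
    rw [← Rack.left_cancel z, Rack.self_distrib]
    simp only [Rack.act_invAct_eq]
  simp only [Function.comp, map12, map13, map23, Wmap, Zmap, h]
end
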